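/- Let F be a field, let n be a positive integer, and let A ∈ GL_n(F) have determinant 1 or −1. Then the augmented matrix A ⊕ I_n ∈ GL_{2n}(F) can be written as a product of three matrices of GL_{2n}(F), two of which are involutions and one of which is a U2-matrix, with the three factors in any prescribed order. -/

import Mathlib

open Matrix Module Polynomial

/-- A ring element that is a product of two involutions. -/
def IsBireflection {R : Type*} [Ring R] (x : R) : Prop :=
  ∃ s t : R, s * s = 1 ∧ t * t = 1 ∧ x = s * t

/-- A ring element that is the product of a unipotent element of index two and two involutions. -/
def IsUnipotentBireflection {R : Type*} [Ring R] (x : R) : Prop :=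
  ∃ u y : R, (u - 1) * (u - 1) = 0 ∧ IsBireflection y ∧ x = u * y

/-- The stabilization `a ⊕ 1` is a product of a unipotent element of index two and
two involutions. -/
def IsStablyUnipotentBireflection {R : Type*} [Ring R] (a : R) : Prop :=
  IsUnipotentBireflection (!![a, 0; 0, 1] : Matrix (Fin 2) (Fin 2) R)

section Ring

variable {R S : Type*} [Ring R] [Ring S]

theorem IsBireflection.map {x : R} (h : IsBireflection x) (f : R →+* S) :
    IsBireflection (f x) := by
  obtain ⟨s, t, hs, ht, rfl⟩ := h
  exact ⟨f s, f t, by rw [← map_mul, hs, map_one], by rw [← map_mul, ht, map_one], map_mul ..⟩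

theorem IsUnipotentBireflection.map {x : R} (h : IsUnipotentBireflection x) (f : R →+* S) :
    IsUnipotentBireflection (f x) := by
  obtain ⟨u, y, hu, hy, rfl⟩ := h
  exact ⟨f u, f y, by rw [← map_one f, ← map_sub, ← map_mul, hu, map_zero], hy.map f, map_mul ..⟩

theorem IsStablyUnipotentBireflection.map {a : R} (h : IsStablyUnipotentBireflection a)
    (f : R →+* S) : IsStablyUnipotentBireflection (f a) := by
  have h' := IsUnipotentBireflection.map h f.mapMatrix
  have e : f.mapMatrix !![a, 0; 0, 1] = !![f a, 0; 0, 1] := by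
    ext i j
    fin_cases i <;> fin_cases j <;> simp
  rwa [e] at h'

theorem isBireflection_of_mul_self {x : R} (h : x * x = 1) : IsBireflection x :=
  ⟨x, 1, h, by simp, by simp⟩

/-- Conjugation by a unit, as a ring homomorphism. -/
def unitConj (g : Rˣ) : R →+* R :=
  MulSemiringAction.toRingHom (ConjAct Rˣ) R (ConjAct.toConjAct g)

theorem unitConj_eq_of_semiconj (g : Rˣ) {x y : R} (h : ↑g * x = y * ↑g) : unitConj g x = y := by
  simp [unitConj, ConjAct.units_smul_def, h]

theorem IsBireflection.of_semiconj {x y g k : R} (hx : IsBireflection x) (hgk : g * k = 1)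
    (hkg : k * g = 1) (h : g * x = y * g) : IsBireflection y :=
  unitConj_eq_of_semiconj ⟨g, k, hgk, hkg⟩ h ▸ hx.map _

theorem IsUnipotentBireflection.of_semiconj {x y g k : R} (hx : IsUnipotentBireflection x)
    (hgk : g * k = 1) (hkg : k * g = 1) (h : g * x = y * g) : IsUnipotentBireflection y :=
  unitConj_eq_of_semiconj ⟨g, k, hgk, hkg⟩ h ▸ hx.map _

theorem IsBireflection.isStablyUnipotentBireflection {a : R} (h : IsBireflection a) :
    IsStablyUnipotentBireflection a := by
  obtain ⟨s, t, hs, ht, rfl⟩ := h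
  refine ⟨1, !![s * t, 0; 0, 1], by simp, ⟨!![s, 0; 0, 1], !![t, 0; 0, 1], ?_, ?_, ?_⟩, by simp⟩ <;>
    simp [one_fin_two, hs, ht]

theorem IsStablyUnipotentBireflection.prod {a : R} {b : S} (ha : IsStablyUnipotentBireflection a)
    (hb : IsStablyUnipotentBireflection b) : IsStablyUnipotentBireflection (a, b) := by
  obtain ⟨u, y, hu, ⟨s, t, hs, ht, rfl⟩, h⟩ := ha
  obtain ⟨u', y', hu', ⟨s', t', hs', ht', rfl⟩, h'⟩ := hb
  have key {x y z : Matrix (Fin 2) (Fin 2) (R × S)}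
      (h1 : x.map Prod.fst * y.map Prod.fst = z.map Prod.fst)
      (h2 : x.map Prod.snd * y.map Prod.snd = z.map Prod.snd) : x * y = z := by
    ext i j
    · simpa [mul_apply] using congrFun₂ h1 i j
    · simpa [mul_apply] using congrFun₂ h2 i j
  let c (m : Matrix (Fin 2) (Fin 2) R) (m' : Matrix (Fin 2) (Fin 2) S) :
    Matrix (Fin 2) (Fin 2) (R × S) := .of fun i j => (m i j, m' i j)
  have hone : c 1 1 = 1 := by
    ext i j <;> simp only [c, of_apply, one_apply] <;> split_ifs <;> rfl
  refine ⟨c u u', c (s * t) (s' * t'), ?_, ⟨c s s', c t t', ?_, ?_, ?_⟩, ?_⟩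
  · rw [← hone]; exact key hu hu'
  · rw [← hone]; exact key hs hs'
  · rw [← hone]; exact key ht ht'
  · exact (key rfl rfl).symm
  · refine (key ?_ ?_).symm
    · refine h.symm.trans ?_
      ext i j; fin_cases i <;> fin_cases j <;> rfl
    · refine h'.symm.trans ?_
      ext i j; fin_cases i <;> fin_cases j <;> rfl

/-- If the block companion matrix of `X ^ 2 - w X + a` is a product of two involutions, then
`a ⊕ 1` is a product of a unipotent element of index two and two involutions. -/
theorem IsBireflection.isStablyUnipotentBireflection_of_companion {a w : R} (ha : IsUnit a)
    (ha' : IsUnit (a - 1)) (h : IsBireflection !![0, -a; 1, w]) :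
    IsStablyUnipotentBireflection a := by
  obtain ⟨⟨a, b, hab, hba⟩, rfl⟩ := ha
  obtain ⟨⟨d, k, hdk, hkd⟩, hd⟩ := ha'
  dsimp only at *
  subst hd
  have hdk' : a * k = k + 1 := by rw [← sub_eq_iff_eq_add', ← hdk]; noncomm_ring
  have hkd' : k * a = k + 1 := by rw [← sub_eq_iff_eq_add', ← hkd]; noncomm_ring
  have hT : IsUnipotentBireflection !![0, -a; 1, 1 + a] := by
    refine ⟨!![1, 0; (w - 1 - a) * b, 1], _, ?_, h, ?_⟩
    · ext i j; fin_cases i <;> fin_cases j <;> simp [mul_apply]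
    · simp [mul_assoc, hba]
      abel
  refine hT.of_semiconj (g := !![k, k * a; -k, -k]) (k := !![-1, -a; 1, 1]) ?_ ?_ ?_
  · simp [one_fin_two, hkd']
  · simp [one_fin_two, hkd', hdk']
  · simp [hkd', hdk', mul_add, add_mul]
    abel_nf
    tauto

theorem IsBireflection.isStablyUnipotentBireflection_of_mul {l r : R} (ha : IsUnit (l * r))
    (ha' : IsUnit (l * r - 1)) (h : IsBireflection !![l, 0; 1, r]) :
    IsStablyUnipotentBireflection (l * r) := by
  refine isStablyUnipotentBireflection_of_companion (w := l + r) ha ha' ?_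
  refine h.of_semiconj (g := !![1, -l; 0, 1]) (k := !![1, l; 0, 1]) ?_ ?_ ?_
  · simp [one_fin_two]
  · simp [one_fin_two]
  · simp

theorem IsBireflection.lower_of_diagonal {l r : R} (hlr : Commute l r) (hu : IsUnit (l - r))
    (h : IsBireflection !![l, 0; 0, r]) : IsBireflection !![l, 0; 1, r] := by
  obtain ⟨⟨d, k, hdk, hkd⟩, hd⟩ := hu
  dsimp only at hd
  subst hd
  have hr : Commute k r := by
    have : Commute (l - r) r := hlr.sub_left (Commute.refl r)
    calc k * r = k * (r * ((l - r) * k)) := by rw [hdk, mul_one]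
      _ = k * ((l - r) * r) * k := by rw [this.eq]; simp only [mul_assoc]
      _ = r * k := by rw [← mul_assoc, hkd, one_mul]
  refine h.of_semiconj (g := !![1, 0; k, 1]) (k := !![1, 0; -k, 1]) ?_ ?_ ?_
  · simp [one_fin_two]
  · simp [one_fin_two]
  · simp
    rw [← hr.eq, ← hkd]
    noncomm_ring

theorem isNilpotent_lower {a b : R} (c : R) (ha : IsNilpotent a) (hb : IsNilpotent b) :
    IsNilpotent !![a, 0; c, b] := by
  have key (n : ℕ) : ∃ c', !![a, 0; c, b] ^ n = !![a ^ n, 0; c', b ^ n] := by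
    induction n with
    | zero => exact ⟨0, by simp [one_fin_two]⟩
    | succ n ih =>
      obtain ⟨c', h⟩ := ih
      exact ⟨c' * a + b ^ n * c, by simp [pow_succ, h]⟩
  obtain ⟨m, hm⟩ := ha
  obtain ⟨n, hn⟩ := hb
  obtain ⟨c', h⟩ := key (m + n)
  refine ⟨(m + n) * 2, ?_⟩
  rw [pow_mul, h, pow_add a, pow_add b, hm, hn, pow_two]
  simp
  ext i j; fin_cases i <;> fin_cases j <;> rfl

end Ring

section Cyclic

variable {F : Type*} [Field F]

theorem exists_involution_adjoinRoot {p : F[X]} {c : F} (hc : c ≠ 0) {y : AdjoinRoot p}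
    (hy : AdjoinRoot.root p * y = 1) (h : aeval (c • y) p = 0) :
    ∃ s : End F (AdjoinRoot p), s * s = 1 ∧
      (∀ b, s (AdjoinRoot.root p * b) = c • (y * s b)) ∧
      ∀ b, s (y * b) = c⁻¹ • (AdjoinRoot.root p * s b) := by
  let σ : AdjoinRoot p →ₐ[F] AdjoinRoot p :=
    AdjoinRoot.liftAlgHom p (Algebra.ofId F _) (c • y) (by simpa [aeval_def] using! h)
  have hr : σ (AdjoinRoot.root p) = c • y := AdjoinRoot.liftAlgHom_root ..
  have hσy : σ y = c⁻¹ • AdjoinRoot.root p := by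
    have h1 : c • y * σ y = 1 := by rw [← hr, ← map_mul, hy, map_one]
    calc σ y = (AdjoinRoot.root p * y) * σ y := by rw [hy, one_mul]
      _ = c⁻¹ • (AdjoinRoot.root p * (c • y * σ y)) := by
        rw [smul_mul_assoc, mul_smul_comm, smul_smul, inv_mul_cancel₀ hc, one_smul, mul_assoc]
      _ = _ := by rw [h1, mul_one]
  have hσσ : σ.comp σ = AlgHom.id F _ := by
    refine AdjoinRoot.algHom_ext ?_
    simp [hr, hσy, smul_smul, hc]
  refine ⟨σ.toLinearMap, LinearMap.ext fun b => DFunLike.congr_fun hσσ b, fun b => ?_, fun b => ?_⟩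
  · simp [hr]
  · simp [hσy]

theorem isBireflection_of_involution {R : Type*} [Ring R] {s x : R} (hs : s * s = 1)
    (h : s * x * (s * x) = 1) : IsBireflection x :=
  ⟨s, s * x, hs, h, by rw [← mul_assoc, hs, one_mul]⟩

theorem exists_involution_adjoinRoot_pow {a : F} (ha : a * a = 1) (e : ℕ) :
    ∃ s : End F (AdjoinRoot ((X - C a) ^ e)), s * s = 1 ∧
      ∀ b, s (AdjoinRoot.root ((X - C a) ^ e) * s (AdjoinRoot.root ((X - C a) ^ e) * b)) = b := by
  set p : F[X] := (X - C a) ^ e with hp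
  set x := AdjoinRoot.root p with hx
  set α := algebraMap F (AdjoinRoot p) a with hα
  have hα2 : α * α = 1 := by rw [← map_mul, ha, map_one]
  have hnil : (x - α) ^ e = 0 := by
    have := AdjoinRoot.mk_self (f := p)
    rwa [hp, map_pow, map_sub, AdjoinRoot.mk_X, AdjoinRoot.mk_C] at this
  have hunit : IsUnit x := by
    have h1 : IsUnit (1 + α * (x - α)) := IsNilpotent.isUnit_one_add ⟨e, by
      rw [mul_pow, hnil, mul_zero]⟩
    have h2 : 1 + α * (x - α) = α * x := by linear_combination -hα2
    rw [h2] at h1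
    exact isUnit_of_mul_isUnit_right h1
  obtain ⟨y, hy⟩ := hunit.exists_right_inv
  obtain ⟨s, hs, h1, -⟩ := exists_involution_adjoinRoot one_ne_zero hy (by
    have : y - α = -(α * y) * (x - α) := by linear_combination α * hy - y * hα2
    have h0 : aeval y ((X - C a) ^ e) = 0 := by
      rw [map_pow, map_sub, aeval_X, aeval_C, ← hα, this, mul_pow, hnil, mul_zero]
    rwa [one_smul])
  refine ⟨s, hs, fun b => ?_⟩
  rw [h1, ← Module.End.mul_apply s s, hs, one_smul, Module.End.one_apply, ← mul_assoc,
    mul_comm y, hy, one_mul]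

end Cyclic

section SquareUnipotent

universe u v

variable {F : Type u} [Field F] {V : Type v} [AddCommGroup V] [Module F V] [FiniteDimensional F V]

open DirectSum

/-- An endomorphism whose square is unipotent is a product of two involutions. -/
theorem isBireflection_of_isNilpotent {T : End F V} (hT : IsNilpotent (T * T - 1)) :
    IsBireflection T := by
  obtain ⟨k, hk⟩ := hT
  set q : F[X] := (X ^ 2 - 1) ^ k with hq
  have hq0 : q ≠ 0 := pow_ne_zero _ (by simpa using X_pow_sub_C_ne_zero (R := F) two_pos 1)
  have hqT : aeval T q = 0 := by simpa [hq, pow_two] using hk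
  have hann (m : AEval' T) : q • m = 0 := by
    obtain ⟨m, rfl⟩ := (AEval'.of T).surjective m
    rw [AEval'.of, ← AEval.of_aeval_smul, hqT, zero_smul, map_zero]
  have htors : IsTorsion F[X] (AEval' T) := fun {m} =>
    ⟨⟨q, mem_nonZeroDivisors_of_ne_zero hq0⟩, hann m⟩
  obtain ⟨ι, _, p, hp, e, ⟨φ⟩⟩ := equiv_directSum_of_isTorsion htors
  have hcomp (i : ι) : ∃ s : End F (F[X] ⧸ F[X] ∙ p i ^ e i), s * s = 1 ∧
      ∀ b, s ((X : F[X]) • s ((X : F[X]) • b)) = b := by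
    classical
    have hdvd : p i ^ e i ∣ q := by
      have h1 : q • lof F[X] ι (fun i => F[X] ⧸ F[X] ∙ p i ^ e i) i
          (Submodule.Quotient.mk 1) = 0 := by
        obtain ⟨m, hm⟩ := φ.surjective
          (lof F[X] ι (fun i => F[X] ⧸ F[X] ∙ p i ^ e i) i (Submodule.Quotient.mk 1))
        rw [← hm, ← map_smul, hann, map_zero]
      have h2 := congrArg (component F[X] ι _ i) h1
      rw [map_smul, component.lof_self, map_zero, ← Submodule.Quotient.mk_smul,
        Submodule.Quotient.mk_eq_zero, smul_eq_mul, mul_one] at h2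
      exact Ideal.mem_span_singleton.mp h2
    have hspan : ∃ a : F, a * a = 1 ∧ F[X] ∙ p i ^ e i = F[X] ∙ (X - C a) ^ e i := by
      rcases Nat.eq_zero_or_pos (e i) with h0 | h0
      · exact ⟨1, one_mul 1, by rw [h0, pow_zero, pow_zero]⟩
      have h1 : p i ∣ (X - C 1) * (X - C (-1)) := by
        have : p i ∣ X ^ 2 - 1 := (hp i).prime.dvd_of_dvd_pow ((dvd_pow_self _ h0.ne').trans hdvd)
        convert this using 1
        simp only [map_neg, map_one]
        ring
      have key (a : F) (ha : a * a = 1) (h : p i ∣ X - C a) :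
          ∃ a : F, a * a = 1 ∧ F[X] ∙ p i ^ e i = F[X] ∙ (X - C a) ^ e i :=
        ⟨a, ha, Ideal.span_singleton_eq_span_singleton.mpr
          (((hp i).associated_of_dvd (irreducible_X_sub_C a) h).pow_pow)⟩
      rcases (hp i).prime.dvd_or_dvd h1 with h | h
      · exact key 1 (by ring) h
      · exact key (-1) (by ring) h
    obtain ⟨a, ha, hspan⟩ := hspan
    rw [hspan]
    obtain ⟨s, hs, hs'⟩ := exists_involution_adjoinRoot_pow ha (e i)
    exact ⟨s, hs, hs'⟩
  choose s hs hs' using hcomp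
  let S : End F (⨁ i, F[X] ⧸ F[X] ∙ p i ^ e i) := lmap s
  have hS (b) : S (S b) = b := by
    ext i : 1
    exact LinearMap.congr_fun (hs i) (b i)
  have hS' (b) : S ((X : F[X]) • S ((X : F[X]) • b)) = b := by
    ext i : 1
    exact hs' i (b i)
  let ψ : V ≃ₗ[F] ⨁ i, F[X] ⧸ F[X] ∙ p i ^ e i := (AEval'.of T).trans (φ.restrictScalars F)
  have hψ (v : V) : ψ (T v) = (X : F[X]) • ψ v := by
    change φ (AEval'.of T (T v)) = (X : F[X]) • φ (AEval'.of T v)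
    rw [← AEval'.X_smul_of, map_smul]
  refine isBireflection_of_involution (s := ψ.symm.conjRingEquiv S) ?_ ?_
  · rw [← map_mul]
    refine LinearMap.ext fun v => ?_
    simp [hS]
  · refine LinearMap.ext fun v => ?_
    simp [hψ, hS']

end SquareUnipotent

section Scalar

variable {F : Type*} [Field F]

theorem IsBireflection.diagonal {R : Type*} [Ring R] {x y : R} (hx : IsBireflection x)
    (hy : IsBireflection y) : IsBireflection !![x, 0; 0, y] := by
  obtain ⟨s, t, hs, ht, rfl⟩ := hx
  obtain ⟨s', t', hs', ht', rfl⟩ := hy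
  exact ⟨!![s, 0; 0, s'], !![t, 0; 0, t'], by simp [one_fin_two, hs, hs'],
    by simp [one_fin_two, ht, ht'], by simp⟩

/-- If `y` is conjugate to the inverse of `x` then `x ⊕ y` is a product of two involutions. -/
theorem isBireflection_diagonal_conj_inv {R : Type*} [Ring R] {x y d d' : R} (hxy : x * y = 1)
    (hyx : y * x = 1) (hd : d * d' = 1) (hd' : d' * d = 1) :
    IsBireflection !![x, 0; 0, d' * y * d] := by
  have h (a b c : R) (h : b * c = 1) : a * b * c = a := by rw [mul_assoc, h, mul_one]
  refine ⟨!![0, x * d; d' * y, 0], !![0, d; d', 0], ?_, ?_, ?_⟩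
  · simp [one_fin_two, ← mul_assoc, h _ _ _ hd, h _ _ _ hyx, hxy, hd']
  · simp [one_fin_two, hd, hd']
  · simp [h _ _ _ hd]

variable {n : ℕ} {c : F}

theorem adjoinRoot_root_pow :
    AdjoinRoot.root (X ^ n - C c) ^ n = algebraMap F (AdjoinRoot ((X : F[X]) ^ n - C c)) c := by
  have := AdjoinRoot.mk_self (f := (X : F[X]) ^ n - C c)
  rwa [map_sub, map_pow, AdjoinRoot.mk_X, AdjoinRoot.mk_C, sub_eq_zero] at this

theorem exists_adjoinRoot_root_mul_eq_one (hn : 0 < n) (hc : c ≠ 0) :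
    ∃ y : AdjoinRoot ((X : F[X]) ^ n - C c), AdjoinRoot.root (X ^ n - C c) * y = 1 := by
  refine IsUnit.exists_right_inv ?_
  rw [← isUnit_pow_iff hn.ne', adjoinRoot_root_pow]
  exact hc.isUnit.map _

/-- Multiplying a root of `X ^ n - c` by an `n`-th root of unity is an algebra endomorphism. -/
theorem exists_algHom_adjoinRoot_root {d : F} (hd : d ^ n = 1) :
    ∃ t : AdjoinRoot ((X : F[X]) ^ n - C c) →ₐ[F] AdjoinRoot ((X : F[X]) ^ n - C c),
      t (AdjoinRoot.root (X ^ n - C c)) = d • AdjoinRoot.root (X ^ n - C c) := by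
  refine ⟨AdjoinRoot.liftAlgHom _ (Algebra.ofId F _) (d • AdjoinRoot.root (X ^ n - C c)) ?_,
    AdjoinRoot.liftAlgHom_root ..⟩
  have : aeval (d • AdjoinRoot.root (X ^ n - C c)) (X ^ n - C c) = 0 := by
    simp [_root_.smul_pow, hd, adjoinRoot_root_pow]
  simpa [aeval_def] using! this

theorem isUnit_adjoinRoot_root_sub {y : AdjoinRoot ((X : F[X]) ^ n - C c)}
    (hy : AdjoinRoot.root (X ^ n - C c) * y = 1) (hc : c ≠ 0) {μ : F} (hμ : μ ^ n ≠ c * c) :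
    IsUnit (AdjoinRoot.root (X ^ n - C c) - μ • y) := by
  refine isUnit_of_dvd_unit (sub_dvd_pow_sub_pow _ _ n) ?_
  have hyn : y ^ n = algebraMap F (AdjoinRoot ((X : F[X]) ^ n - C c)) c⁻¹ := by
    have h1 : algebraMap F (AdjoinRoot ((X : F[X]) ^ n - C c)) c * y ^ n = 1 := by
      rw [← adjoinRoot_root_pow, ← mul_pow, hy, one_pow]
    calc y ^ n = algebraMap F (AdjoinRoot ((X : F[X]) ^ n - C c)) (c⁻¹ * c) * y ^ n := by
          rw [inv_mul_cancel₀ hc, map_one, one_mul]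
      _ = _ := by rw [map_mul, mul_assoc, h1, mul_one]
  rw [_root_.smul_pow, adjoinRoot_root_pow, hyn, Algebra.smul_def, ← map_mul, ← map_sub]
  refine IsUnit.map _ (sub_ne_zero.mpr fun h => hμ ?_).isUnit
  calc μ ^ n = μ ^ n * c⁻¹ * c := by rw [mul_assoc, inv_mul_cancel₀ hc, mul_one]
    _ = c * c := by rw [← h]

theorem isStablyUnipotentBireflection_smul_one_of_adjoinRoot {μ : F} (h0 : μ ≠ 0) (h1 : μ ≠ 1)
    (hc : c ≠ 0) (hμ : μ ^ n ≠ c * c)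
    {y : AdjoinRoot ((X : F[X]) ^ n - C c)} (hy : AdjoinRoot.root (X ^ n - C c) * y = 1)
    (h : IsBireflection !![Algebra.lmul F (AdjoinRoot ((X : F[X]) ^ n - C c))
      (AdjoinRoot.root (X ^ n - C c)), 0; 0, μ • Algebra.lmul F _ y]) :
    IsStablyUnipotentBireflection (μ • 1 : End F (AdjoinRoot ((X : F[X]) ^ n - C c))) := by
  have hmul : Algebra.lmul F (AdjoinRoot ((X : F[X]) ^ n - C c))
      (AdjoinRoot.root (X ^ n - C c)) * μ • Algebra.lmul F _ y = μ • 1 := by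
    rw [mul_smul_comm, ← map_mul, hy, map_one]
  rw [← hmul]
  refine (h.lower_of_diagonal ?_ ?_).isStablyUnipotentBireflection_of_mul ?_ ?_
  · rw [← map_smul]
    exact (Commute.all _ _).map _
  · rw [← map_smul, ← map_sub]
    exact (isUnit_adjoinRoot_root_sub hy hc hμ).map _
  · rw [hmul]
    exact (isUnit_one).smul (Units.mk0 μ h0)
  · rw [hmul]
    have := (isUnit_one (M := End F (AdjoinRoot ((X : F[X]) ^ n - C c)))).smul
      (Units.mk0 (μ - 1) (sub_ne_zero.mpr h1))
    simpa [Units.smul_def, sub_smul] using this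

theorem isStablyUnipotentBireflection_smul_one_of_pow_eq_one {μ : F} (hn : 0 < n) (h : μ ^ n = 1)
    (h2 : μ * μ ≠ 1) :
    IsStablyUnipotentBireflection (μ • 1 : End F (AdjoinRoot ((X : F[X]) ^ n - C μ))) := by
  have h0 : μ ≠ 0 := by rintro rfl; simp [hn.ne'] at h
  have h1 : μ ≠ 1 := by rintro rfl; simp at h2
  obtain ⟨y, hy⟩ := exists_adjoinRoot_root_mul_eq_one hn h0
  refine isStablyUnipotentBireflection_smul_one_of_adjoinRoot h0 h1 h0 (h ▸ h2.symm) hy ?_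
  obtain ⟨t, ht⟩ := exists_algHom_adjoinRoot_root (c := μ) h
  obtain ⟨t', ht'⟩ := exists_algHom_adjoinRoot_root (c := μ) (d := μ⁻¹) (n := n)
    (by rw [inv_pow, h, inv_one])
  have htt' : t.comp t' = AlgHom.id F _ := AdjoinRoot.algHom_ext (by simp [ht, ht', smul_smul, h0])
  have ht't : t'.comp t = AlgHom.id F _ := AdjoinRoot.algHom_ext (by simp [ht, ht', smul_smul, h0])
  have hty : t' y = μ • y := by
    have h3 : μ⁻¹ • AdjoinRoot.root (X ^ n - C μ) * t' y = 1 := by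
      rw [← ht', ← map_mul, hy, map_one]
    calc t' y = (AdjoinRoot.root (X ^ n - C μ) * y) * t' y := by rw [hy, one_mul]
      _ = μ • (y * (μ⁻¹ • AdjoinRoot.root (X ^ n - C μ) * t' y)) := by
        rw [smul_mul_assoc, mul_smul_comm, smul_smul, mul_inv_cancel₀ h0, one_smul]; ring
      _ = _ := by rw [h3, mul_one]
  have hd : (t.toLinearMap : End F (AdjoinRoot (X ^ n - C μ))) * t'.toLinearMap = 1 :=
    LinearMap.ext fun b => DFunLike.congr_fun htt' b
  have hd' : (t'.toLinearMap : End F (AdjoinRoot (X ^ n - C μ))) * t.toLinearMap = 1 :=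
    LinearMap.ext fun b => DFunLike.congr_fun ht't b
  have hconj : μ • Algebra.lmul F (AdjoinRoot (X ^ n - C μ)) y =
      t'.toLinearMap * Algebra.lmul F _ y * t.toLinearMap := by
    refine LinearMap.ext fun b => ?_
    have : t' (t b) = b := DFunLike.congr_fun ht't b
    simp [hty, this]
  rw [hconj]
  refine isBireflection_diagonal_conj_inv ?_ ?_ hd hd'
  · rw [← map_mul, hy, map_one]
  · rw [← map_mul, mul_comm, hy, map_one]

theorem isStablyUnipotentBireflection_smul_one_of_pow_eq_neg_one {μ : F} (hn : 0 < n)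
    (h : μ ^ n = -1) (h2 : (1 : F) ≠ -1) :
    IsStablyUnipotentBireflection (μ • 1 : End F (AdjoinRoot ((X : F[X]) ^ n - C 1))) := by
  have h0 : μ ≠ 0 := by rintro rfl; simp [hn.ne'] at h
  have h1 : μ ≠ 1 := by rintro rfl; exact h2 (by simpa using h)
  obtain ⟨y, hy⟩ := exists_adjoinRoot_root_mul_eq_one hn (one_ne_zero (α := F))
  have hyn : y ^ n = 1 := by
    have := congrArg (· ^ n) hy
    simpa [mul_pow, adjoinRoot_root_pow] using this
  refine isStablyUnipotentBireflection_smul_one_of_adjoinRoot h0 h1 one_ne_zero ?_ hy ?_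
  · rw [h, one_mul]; exact h2.symm
  have key (d : F) (hd : d ^ n = 1) : aeval (d • y) ((X : F[X]) ^ n - C 1) = 0 := by
    rw [map_sub, map_pow, aeval_X, aeval_C, _root_.smul_pow, hd, hyn, one_smul,
      (algebraMap F _).map_one]
    exact sub_self 1
  refine IsBireflection.diagonal ?_ ?_
  · obtain ⟨s, hs, hs1, -⟩ := exists_involution_adjoinRoot one_ne_zero hy (key 1 (one_pow n))
    refine isBireflection_of_involution hs (LinearMap.ext fun b => ?_)
    change s (AdjoinRoot.root _ * s (AdjoinRoot.root _ * b)) = b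
    rw [hs1, ← Module.End.mul_apply s s, hs, one_smul, Module.End.one_apply, ← mul_assoc,
      mul_comm y, hy, one_mul]
  · obtain ⟨s, hs, -, hs1⟩ := exists_involution_adjoinRoot (pow_ne_zero 2 h0) hy
      (key (μ ^ 2) (by rw [← pow_mul, mul_comm, pow_mul, h]; ring))
    refine isBireflection_of_involution hs (LinearMap.ext fun b => ?_)
    change s (μ • (y * s (μ • (y * b)))) = b
    rw [map_smul, hs1, ← Module.End.mul_apply s s, hs, Module.End.one_apply, mul_smul_comm,
      ← mul_assoc, hy, one_mul, smul_smul, smul_smul]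
    have : μ * (μ ^ 2)⁻¹ * μ = 1 := by field_simp
    rw [this, one_smul]

theorem isStablyUnipotentBireflection_smul_one {V : Type*} [AddCommGroup V] [Module F V]
    [FiniteDimensional F V] {μ : F} (h : μ ^ finrank F V = 1 ∨ μ ^ finrank F V = -1) :
    IsStablyUnipotentBireflection (μ • 1 : End F V) := by
  by_cases h2 : μ * μ = 1
  · refine (isBireflection_of_mul_self ?_).isStablyUnipotentBireflection
    rw [smul_mul_smul_comm, h2, one_smul, one_mul]
  rcases Nat.eq_zero_or_pos (finrank F V) with hn | hn
  · have := finrank_zero_iff.mp hn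
    exact (isBireflection_of_mul_self (Subsingleton.elim _ _)).isStablyUnipotentBireflection
  have key {c : F} (hc : IsStablyUnipotentBireflection
      (μ • 1 : End F (AdjoinRoot ((X : F[X]) ^ finrank F V - C c)))) :
      IsStablyUnipotentBireflection (μ • 1 : End F V) := by
    have hm : ((X : F[X]) ^ finrank F V - C c).Monic := monic_X_pow_sub_C c hn.ne'
    have := hm.finite_adjoinRoot
    have e : AdjoinRoot ((X : F[X]) ^ finrank F V - C c) ≃ₗ[F] V := by
      refine LinearEquiv.ofFinrankEq _ _ ?_
      rw [(AdjoinRoot.powerBasis' hm).finrank, AdjoinRoot.powerBasis'_dim, natDegree_X_pow_sub_C]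
    convert hc.map e.conjRingEquiv.toRingHom using 1
    ext v
    simp
  by_cases h1 : μ ^ finrank F V = 1
  · exact key (isStablyUnipotentBireflection_smul_one_of_pow_eq_one hn h1 h2)
  · have h' := h.resolve_left h1
    exact key (isStablyUnipotentBireflection_smul_one_of_pow_eq_neg_one hn h'
      fun h3 => h1 (h'.trans h3.symm))

end Scalar

section Factorization

variable {F V : Type*} [Field F] [AddCommGroup V] [Module F V]

theorem LinearIndependent.exists_dual {ι : Type*} {b : ι → V} (hb : LinearIndependent F b)
    (c : ι → F) : ∃ φ : V →ₗ[F] F, ∀ i, φ (b i) = c i := by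
  obtain ⟨φ, hφ⟩ := LinearMap.exists_extend ((Basis.span hb).constr F c)
  refine ⟨φ, fun i => ?_⟩
  have h := LinearMap.congr_fun hφ (Basis.span hb i)
  rw [Basis.constr_basis] at h
  simpa [Basis.span_apply] using h

/-- The projection onto the kernel of `φ` along `v`. -/
def kerProj (φ : V →ₗ[F] F) {v : V} (hv : φ v = 1) : V →ₗ[F] LinearMap.ker φ :=
  (LinearMap.id - φ.smulRight v).codRestrict _ fun x => by simp [hv]

section

variable {φ : V →ₗ[F] F} {v : V} (hv : φ v = 1)

@[simp] theorem coe_kerProj (x : V) : (kerProj φ hv x : V) = x - φ x • v := rfl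

@[simp] theorem kerProj_coe (x : LinearMap.ker φ) : kerProj φ hv x = x := by
  ext; simp

@[simp] theorem kerProj_self : kerProj φ hv v = 0 := by
  ext; simp [hv]

/-- The splitting of `V` along `ker φ` and `v`. -/
def kerEquiv : V ≃ₗ[F] LinearMap.ker φ × F :=
  .ofLinearMap ((kerProj φ hv).prod φ)
    ((LinearMap.ker φ).subtype.coprod (LinearMap.toSpanSingleton F V v))
    (by ext <;> simp [hv]) (by ext; simp)

theorem isNilpotent_of_kerProj {f : End F V} (h : φ ∘ₗ f = 0 ∨ f v = 0)
    (hf : IsNilpotent (kerProj φ hv ∘ₗ f ∘ₗ (LinearMap.ker φ).subtype : End F (LinearMap.ker φ))) :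
    IsNilpotent f := by
  obtain ⟨k, hk⟩ := hf
  refine ⟨k + 1, LinearMap.ext fun x => ?_⟩
  rcases h with h | h
  · have hf (x) : f x = kerProj φ hv (f x) := by
      simp [show φ (f x) = 0 from LinearMap.congr_fun h x]
    have hc := Module.End.commute_pow_left_of_commute (f := (LinearMap.ker φ).subtype) (g₂ := f)
      (g := kerProj φ hv ∘ₗ f ∘ₗ (LinearMap.ker φ).subtype) (LinearMap.ext fun x => hf x) k
    rw [pow_succ, Module.End.mul_apply, hf]
    exact (LinearMap.congr_fun hc (kerProj φ hv (f x))).trans (by rw [hk]; rfl)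
  · have hf (x) : f (kerProj φ hv x) = f x := by simp [h]
    have hc := Module.End.commute_pow_left_of_commute (f := kerProj φ hv) (g := f)
      (g₂ := kerProj φ hv ∘ₗ f ∘ₗ (LinearMap.ker φ).subtype)
      (LinearMap.ext fun x => by simp [h]) k
    rw [pow_succ', Module.End.mul_apply, ← hf]
    have h0 : kerProj φ hv ((f ^ k) x) = 0 :=
      (LinearMap.congr_fun hc x).symm.trans (by simp [hk])
    simp [h0]

/-- The compression of `A` to `ker φ` along `A v`. -/
def kerCompress (A : End F V) (hA : φ (A v) = 1) : End F (LinearMap.ker φ) :=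
  kerProj φ hA ∘ₗ A ∘ₗ (LinearMap.ker φ).subtype

/-- The endomorphism that agrees with `B` on `ker φ` and maps `v` to `w`. -/
def kerExtend (B : End F (LinearMap.ker φ)) (w : V) : End F V :=
  (LinearMap.ker φ).subtype ∘ₗ B ∘ₗ kerProj φ hv + φ.smulRight w

theorem kerExtend_apply (B : End F (LinearMap.ker φ)) (w x : V) :
    kerExtend hv B w x = B (kerProj φ hv x) + φ x • w := rfl

theorem apply_kerExtend (B : End F (LinearMap.ker φ)) {w : V} (hw : φ w = 1) (x : V) :
    φ (kerExtend hv B w x) = φ x := by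
  simp [kerExtend_apply, hw]

theorem det_kerExtend [FiniteDimensional F V] (B : End F (LinearMap.ker φ)) {w : V}
    (hw : φ w = 1) : LinearMap.det (kerExtend hv B w) = LinearMap.det B := by
  have h1 : kerExtend hv B w =
      LinearMap.transvection φ (w - v) ∘ₗ kerExtend hv B v := by
    ext x
    simp [LinearMap.transvection, kerExtend_apply, smul_sub, hv]
  have h2 : kerExtend hv B v = (kerEquiv hv).symm.toLinearMap ∘ₗ (B.prodMap LinearMap.id) ∘ₗ
      (kerEquiv hv).toLinearMap := by
    ext x
    simp [kerExtend_apply, kerEquiv]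
  rw [h1, LinearMap.det_comp, LinearMap.transvection.det, h2]
  have := LinearMap.det_conj (B.prodMap (LinearMap.id : End F F)) (kerEquiv hv).symm
  rw [LinearEquiv.symm_symm] at this
  rw [this, LinearMap.det_prodMap]
  simp [hv, hw]

/-- The endomorphism `x ↦ B (p x) + φ (A x) v`, where `p` is the projection onto `ker φ`
along `v`. -/
def kerExtend' (A : End F V) (B : End F (LinearMap.ker φ)) : End F V :=
  (LinearMap.ker φ).subtype ∘ₗ B ∘ₗ kerProj φ hv + (φ ∘ₗ A).smulRight v

theorem kerExtend'_apply (A : End F V) (B : End F (LinearMap.ker φ)) (x : V) :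
    kerExtend' hv A B x = B (kerProj φ hv x) + φ (A x) • v := rfl

theorem kerExtend_mul_kerExtend' (A : End F V) (hA : φ (A v) = 1)
    {B C : End F (LinearMap.ker φ)} (h : B * C = kerCompress A hA) :
    kerExtend hv B (A v) * kerExtend' hv A C = A := by
  ext x
  have : B (C (kerProj φ hv x)) = kerCompress A hA (kerProj φ hv x) := LinearMap.congr_fun h _
  simp [kerExtend_apply, kerExtend'_apply, hv, this, kerCompress]

theorem det_kerCompress [FiniteDimensional F V] (hv : φ v = 1) (A : End F V) (hA : φ (A v) = 1) :
    LinearMap.det (kerCompress A hA) = LinearMap.det A := by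
  conv_rhs => rw [← kerExtend_mul_kerExtend' hv A hA (mul_one _), map_mul, det_kerExtend hv _ hA]
  have : kerExtend' hv A 1 = LinearMap.transvection (φ ∘ₗ A - φ) v := by
    ext x
    simp [kerExtend'_apply, LinearMap.transvection]
    module
  rw [this, LinearMap.transvection.det]
  simp [hv, hA]

theorem isNilpotent_kerExtend {B : End F (LinearMap.ker φ)} {w : V} (hw : φ w = 1)
    (hB : IsNilpotent (B * B - 1)) :
    IsNilpotent (kerExtend hv B w * kerExtend hv B w - 1) := by
  refine isNilpotent_of_kerProj hv (.inl <| LinearMap.ext fun x => ?_) ?_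
  · simp [apply_kerExtend hv B hw]
  · convert hB using 1
    ext x
    simp [kerExtend_apply]

theorem isNilpotent_kerExtend' {A : End F V} (hA : φ (A v) = 1) {B : End F (LinearMap.ker φ)}
    (hB : IsNilpotent (B * B - 1)) :
    IsNilpotent (kerExtend' hv A B * kerExtend' hv A B - 1) := by
  refine isNilpotent_of_kerProj hv (.inr ?_) ?_
  · simp [kerExtend'_apply, hA]
  · convert hB using 1
    ext x
    simp [kerExtend'_apply]

end

theorem exists_linearIndependent_of_ne_smul_one {A : End F V} (h : ∀ c : F, A ≠ c • 1) :
    ∃ v, LinearIndependent F ![v, A v] := by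
  by_contra! hc
  obtain ⟨c, hc⟩ := LinearMap.exists_eq_smul_id_of_forall_notLinearIndependent hc
  exact h c hc

theorem exists_dual_kerCompress_ne_smul_one [FiniteDimensional F V] {A : End F V}
    (hA : Function.Injective A) (h : ∀ c : F, A ≠ c • 1) :
    ∃ (φ : V →ₗ[F] F) (v : V) (_ : φ v = 1) (hAv : φ (A v) = 1),
      finrank F (LinearMap.ker φ) = 1 ∨ ∀ c : F, kerCompress A hAv ≠ c • 1 := by
  obtain ⟨v, hv⟩ := exists_linearIndependent_of_ne_smul_one h
  have hpair := LinearIndependent.pair_iff.mp hv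
  rcases hv.fintype_card_le_finrank.eq_or_lt with h2 | h3
  · obtain ⟨φ, hφ⟩ := hv.exists_dual ![1, 1]
    refine ⟨φ, v, hφ 0, hφ 1, .inl ?_⟩
    have hφ0 : φ ≠ 0 := by rintro rfl; simpa using hφ 0
    have := Module.Dual.finrank_ker_add_one_of_ne_zero hφ0
    simp at h2
    omega
  · obtain ⟨u, hu⟩ := exists_linearIndependent_cons_of_lt_finrank hv (by simpa using h3)
    obtain ⟨φ, hφ⟩ := hu.exists_dual ![0, 1, 1]
    obtain ⟨ψ, hψ⟩ := hu.exists_dual ![1, 1, 1]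
    have hφu : φ u = 0 := hφ 0
    have hφv : φ v = 1 := hφ 1
    have hφA : φ (A v) = 1 := hφ 2
    have hψu : ψ u = 1 := hψ 0
    have hψv : ψ v = 1 := hψ 1
    have hψA : ψ (A v) = 1 := hψ 2
    by_contra! hcon
    obtain ⟨-, c, hc⟩ := hcon φ v hφv hφA
    obtain ⟨-, d, hd⟩ := hcon ψ v hψv hψA
    have hc' (x : V) (hx : φ x = 0) : A x - φ (A x) • A v = c • x :=
      congrArg Subtype.val (LinearMap.congr_fun hc ⟨x, hx⟩)
    have hd' (x : V) (hx : ψ x = 0) : A x - ψ (A x) • A v = d • x :=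
      congrArg Subtype.val (LinearMap.congr_fun hd ⟨x, hx⟩)
    have hcd : c = d := by
      have h1 := hc' (A v - v) (by simp [hφv, hφA])
      have h2 := hd' (A v - v) (by simp [hψv, hψA])
      refine sub_eq_zero.mp (hpair (c - d)
        (ψ (A (A v - v)) - φ (A (A v - v)) - (c - d)) ?_).1
      linear_combination (norm := module) h1 - h2
    subst hcd
    have h1 := hc' u hφu
    have h2 := hd' (u - v) (by simp [hψu, hψv])
    rw [map_sub A] at h2
    have hc0 : c = 0 := by
      refine neg_eq_zero.mp (hpair (-c) (1 - φ (A u) + ψ (A u - A v)) ?_).1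
      linear_combination (norm := module) h1 - h2
    have huv : u = φ (A u) • v := hA (by rw [map_smul, ← sub_eq_zero, h1, hc0, zero_smul])
    refine (linearIndependent_finCons.mp hu).2 ?_
    rw [huv]
    exact Submodule.smul_mem _ _ (Submodule.subset_span ⟨0, rfl⟩)

/-- An endomorphism whose determinant squares to one, and which is nonscalar or acts on a line,
is a product of two endomorphisms with unipotent squares. -/
theorem exists_mul_eq_of_det_mul_self [FiniteDimensional F V] {A : End F V}
    (hdet : LinearMap.det A * LinearMap.det A = 1)
    (h : finrank F V = 1 ∨ ∀ c : F, A ≠ c • 1) :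
    ∃ L U : End F V, L * U = A ∧ IsNilpotent (L * L - 1) ∧ IsNilpotent (U * U - 1) := by
  obtain ⟨n, hn⟩ : ∃ n, finrank F V = n := ⟨_, rfl⟩
  induction n generalizing V with
  | zero =>
    have := finrank_zero_iff.mp hn
    exact ⟨1, A, one_mul A, by simp, ⟨1, Subsingleton.elim _ _⟩⟩
  | succ n ih =>
    by_cases hs : ∃ c : F, A = c • 1
    · obtain ⟨c, rfl⟩ := hs
      have h1 := h.resolve_right fun h => h c rfl
      refine ⟨1, c • 1, one_mul _, by simp, ⟨1, ?_⟩⟩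
      simp [h1] at hdet
      rw [smul_mul_smul_comm, hdet, one_smul, one_mul, sub_self, pow_one]
    · push Not at hs
      have hA : Function.Injective A := by
        refine (LinearMap.isUnit_iff_ker_eq_bot A |>.mp ?_ |> LinearMap.ker_eq_bot.mp)
        exact LinearMap.isUnit_iff_isUnit_det A |>.mpr (.of_mul_eq_one _ hdet)
      obtain ⟨φ, v, hv, hAv, hφ⟩ := exists_dual_kerCompress_ne_smul_one hA hs
      have hφ0 : φ ≠ 0 := by rintro rfl; simp at hv
      have := Module.Dual.finrank_ker_add_one_of_ne_zero hφ0
      obtain ⟨L, U, hLU, hL, hU⟩ := ih (A := kerCompress A hAv)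
        (by rwa [det_kerCompress hv]) hφ (by omega)
      exact ⟨_, _, kerExtend_mul_kerExtend' hv A hAv hLU, isNilpotent_kerExtend hv hAv hL,
        isNilpotent_kerExtend' hv hAv hU⟩

end Factorization

section Stable

theorem IsBireflection.det_eq {F V : Type*} [Field F] [AddCommGroup V] [Module F V]
    {A : End F V} (h : IsBireflection A) :
    LinearMap.det A = 1 ∨ LinearMap.det A = -1 := by
  obtain ⟨s, t, hs, ht, rfl⟩ := h
  have key {x : End F V} (hx : x * x = 1) : LinearMap.det x = 1 ∨ LinearMap.det x = -1 :=
    mul_self_eq_one_iff.mp (by rw [← map_mul, hx, map_one])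
  rcases key hs with h | h <;> rcases key ht with h' | h' <;> simp [h, h']

variable {F V : Type*} [Field F] [AddCommGroup V] [Module F V] [FiniteDimensional F V]

theorem isBireflection_matrix_of_isNilpotent {T : Matrix (Fin 2) (Fin 2) (End F V)}
    (hT : IsNilpotent (T * T - 1)) : IsBireflection T := by
  let e := endVecRingEquivMatrixEnd (Fin 2) F V
  have h : IsNilpotent (e.symm T * e.symm T - 1) := by
    simpa using hT.map e.symm
  simpa using (isBireflection_of_isNilpotent h).map e.toRingHom

theorem isStablyUnipotentBireflection_of_ne_smul_one {A : End F V}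
    (hdet : LinearMap.det A * LinearMap.det A = 1) (h : ∀ c : F, A ≠ c • 1)
    (hA : IsUnit (A - 1)) : IsStablyUnipotentBireflection A := by
  have hu : IsUnit A := (LinearMap.isUnit_iff_isUnit_det A).mpr (.of_mul_eq_one _ hdet)
  obtain ⟨L, U, rfl, hL, hU⟩ := exists_mul_eq_of_det_mul_self hdet (.inr h)
  refine (isBireflection_matrix_of_isNilpotent ?_).isStablyUnipotentBireflection_of_mul hu hA
  convert isNilpotent_lower (L + U) hL hU using 1
  ext i j : 2
  fin_cases i <;> fin_cases j <;> simp [one_fin_two]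

theorem isStablyUnipotentBireflection_of_isUnit_sub_one {A : End F V}
    (hdet : LinearMap.det A = 1 ∨ LinearMap.det A = -1) (hA : IsUnit (A - 1)) :
    IsStablyUnipotentBireflection A := by
  by_cases h : ∃ c : F, A = c • 1
  · obtain ⟨c, rfl⟩ := h
    refine isStablyUnipotentBireflection_smul_one ?_
    simpa using hdet
  · push Not at h
    exact isStablyUnipotentBireflection_of_ne_smul_one (by rcases hdet with h | h <;> simp [h]) h hA

theorem isBireflection_of_isNilpotent_sub_one {A : End F V} (h : IsNilpotent (A - 1)) :
    IsBireflection A := by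
  refine isBireflection_of_isNilpotent ?_
  have : A * A - 1 = (A - 1) * (A + 1) := by noncomm_ring
  rw [this]
  exact Commute.isNilpotent_mul_right (by rw [commute_iff_eq]; noncomm_ring) h

/-- If `det A = ±1` then `A ⊕ 1` is a product of a unipotent of index two and two involutions. -/
theorem isStablyUnipotentBireflection_of_det {A : End F V}
    (hdet : LinearMap.det A = 1 ∨ LinearMap.det A = -1) : IsStablyUnipotentBireflection A := by
  obtain ⟨k, hc, hk⟩ := ((LinearMap.eventually_isCompl_ker_pow_range_pow (A - 1)).and
    (Filter.eventually_ge_atTop 1)).exists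
  set K := LinearMap.ker ((A - 1) ^ k) with hKdef
  set R := LinearMap.range ((A - 1) ^ k)
  have hcomm : Commute A ((A - 1) ^ k) :=
    ((Commute.refl A).sub_right (Commute.one_right A)).pow_right k
  have hK : ∀ x ∈ K, A x ∈ K := fun x hx => by
    have := LinearMap.congr_fun hcomm.eq x
    simp only [K, LinearMap.mem_ker, Module.End.mul_apply] at hx this ⊢
    rw [← this, hx, map_zero]
  have hR : ∀ x ∈ R, A x ∈ R := by
    rintro _ ⟨x, rfl⟩
    exact ⟨A x, (LinearMap.congr_fun hcomm.eq x).symm⟩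
  let e := Submodule.prodEquivOfIsCompl K R hc
  have hA : A = e.conjRingEquiv ((A.restrict hK).prodMap (A.restrict hR)) := by
    refine LinearMap.ext fun x => ?_
    obtain ⟨y, rfl⟩ := e.surjective x
    simp [e, Submodule.coe_prodEquivOfIsCompl']
  have hAK : IsBireflection (A.restrict hK) := by
    refine isBireflection_of_isNilpotent_sub_one ⟨k, LinearMap.ext fun x => Subtype.ext ?_⟩
    have := Module.End.commute_pow_left_of_commute (f := K.subtype) (g₂ := A - 1)
      (g := A.restrict hK - 1) rfl k
    exact (LinearMap.congr_fun this x).symm.trans x.2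
  have hAR : IsUnit (A.restrict hR - 1) := by
    refine (LinearMap.isUnit_iff_ker_eq_bot _).mpr (LinearMap.ker_eq_bot'.mpr fun x hx => ?_)
    have hx' : (A - 1) x = 0 := congrArg Subtype.val hx
    have hxK : (x : V) ∈ K := by
      rw [hKdef, LinearMap.mem_ker, ← Nat.sub_add_cancel hk, pow_succ, Module.End.mul_apply, hx',
        map_zero]
    exact Subtype.ext (Submodule.disjoint_def.mp hc.disjoint _ hxK x.2)
  have hAdet : LinearMap.det A =
      LinearMap.det (A.restrict hK) * LinearMap.det (A.restrict hR) := by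
    rw [← LinearMap.det_prodMap]
    conv_lhs => rw [hA]
    exact LinearMap.det_conj ((A.restrict hK).prodMap (A.restrict hR)) e
  have hRdet : LinearMap.det (A.restrict hR) = 1 ∨ LinearMap.det (A.restrict hR) = -1 := by
    rw [hAdet] at hdet
    rcases hAK.det_eq with h | h <;> simpa [h, neg_eq_iff_eq_neg, or_comm] using hdet
  rw [hA]
  exact (hAK.isStablyUnipotentBireflection.prod
    (isStablyUnipotentBireflection_of_isUnit_sub_one hRdet hAR)).map
      (e.conjRingEquiv.toRingHom.comp (LinearMap.prodMapRingHom F K R))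

/-- Two by two block matrices with entries in a matrix ring, as matrices. -/
def blockRingHom (m R : Type*) [Fintype m] [DecidableEq m] [Ring R] :
    Matrix (Fin 2) (Fin 2) (Matrix m m R) →+* Matrix (m ⊕ m) (m ⊕ m) R where
  toFun M := fromBlocks (M 0 0) (M 0 1) (M 1 0) (M 1 1)
  map_one' := by simp
  map_zero' := by simp
  map_mul' M N := by simp [fromBlocks_multiply, mul_apply]
  map_add' M N := by simp [fromBlocks_add]

end Stable

/-- The factor of index two can be moved to any position. -/
theorem IsUnipotentBireflection.exists_prod {R : Type*} [Ring R] {x : R}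
    (h : IsUnipotentBireflection x) (k : Fin 3) :
    ∃ B : Fin 3 → R, (∀ j, j ≠ k → B j * B j = 1) ∧ (B k - 1) * (B k - 1) = 0 ∧
      x = B 0 * B 1 * B 2 := by
  obtain ⟨u, -, hu, ⟨s, t, hs, ht, rfl⟩, rfl⟩ := h
  have hs' (x : R) : s * (s * x) = x := by rw [← mul_assoc, hs, one_mul]
  have ht' (x : R) : t * (t * x) = x := by rw [← mul_assoc, ht, one_mul]
  have h1 {g g' : R} (hg : g' * g = 1) (hg' : g * g' = 1) :
      (g * u * g' - 1) * (g * u * g' - 1) = 0 := by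
    have : g * u * g' - 1 = g * (u - 1) * g' := by rw [mul_sub, mul_one, sub_mul, hg']
    calc _ = g * (u - 1) * (g' * g) * (u - 1) * g' := by rw [this]; simp only [mul_assoc]
      _ = g * ((u - 1) * (u - 1)) * g' := by rw [hg]; simp only [mul_assoc, one_mul]
      _ = 0 := by rw [hu]; simp
  fin_cases k
  · refine ⟨![u, s, t], ?_, hu, (mul_assoc ..).symm⟩
    intro j hj
    fin_cases j <;> simp_all
  · refine ⟨![s, s * u * s, t], ?_, h1 hs hs, ?_⟩
    · intro j hj
      fin_cases j <;> simp_all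
    · simp [mul_assoc, hs']
  · refine ⟨![s, t, t * s * u * (s * t)], ?_, h1 ?_ ?_, ?_⟩
    · intro j hj
      fin_cases j <;> simp_all
    · simp [mul_assoc, ht', hs]
    · simp [mul_assoc, hs', ht]
    · simp [mul_assoc, hs', ht']

/-- **Stable length-3 problem, two involutions and one U2-matrix (any prescribed order).**
Let `F` be a field, `n` a positive integer, and `A ∈ GLₙ(F)` with `det A = ±1`.
Then, for any prescribed position `k` of the U2-factor, `A ⊕ Iₙ` is a product of three
matrices where the factor at position `k` is a U2-matrix and the other two are involutions. -/
theorem stmt2 {F : Type*} [Field F] {n : ℕ} (hn : 0 < n)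
    (A : Matrix (Fin n) (Fin n) F) (hA : IsUnit A)
    (hdet : A.det = 1 ∨ A.det = -1) (k : Fin 3) :
    ∃ B : Fin 3 → Matrix (Fin (n + n)) (Fin (n + n)) F,
      (∀ j, j ≠ k → B j * B j = 1) ∧
      (B k - 1) * (B k - 1) = 0 ∧
      Matrix.reindex finSumFinEquiv finSumFinEquiv
        (Matrix.fromBlocks A 0 0 (1 : Matrix (Fin n) (Fin n) F)) = B 0 * B 1 * B 2 := by
  have h := (isStablyUnipotentBireflection_of_det (A := Matrix.toLin' A) (by simpa using hdet)).map
    (LinearMap.toMatrixAlgEquiv' (R := F) (n := Fin n)).toRingHom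
  rw [show (LinearMap.toMatrixAlgEquiv' (R := F) (n := Fin n)).toRingHom (toLin' A) = A from
    LinearMap.toMatrix'_toLin' A] at h
  have h' : IsUnipotentBireflection (Matrix.reindex finSumFinEquiv finSumFinEquiv
        (Matrix.fromBlocks A 0 0 (1 : Matrix (Fin n) (Fin n) F))) := by
    convert (IsUnipotentBireflection.map h (blockRingHom (Fin n) F)).map
      (reindexRingEquiv F (finSumFinEquiv (m := n) (n := n))).toRingHom using 1
    rfl
  exact h'.exists_prod k
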